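/- Assume ∫_a^b r₊(s) ds > 0, where r₊ = max(r, 0). Then for every real λ with λ sufficiently large, any nontrivial real solution of -(p y')' + q y = λ r y on [a,b] has at least one zero in (a,b), provided p is bounded above and r₊ ≥ δ > 0 on some subinterval [c,d] ⊂ (a,b). -/

import Mathlib

open MeasureTheory

/-- Real solution of `-(p y')' + q y = λ r y` on `[a,b]` in the absolutely
continuous (Carathéodory) sense, with quasi-derivative `py = p·y'`. -/
def IsRealSLSolution (p q r : ℝ → ℝ) (a b : ℝ) (l : ℝ) (y py : ℝ → ℝ) : Prop :=
  (∀ x ∈ Set.Icc a b, y x = y a + ∫ t in a..x, py t / p t) ∧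
  (∀ x ∈ Set.Icc a b, py x = py a + ∫ t in a..x, (q t * y t - l * r t * y t))

theorem aux_ac_inv {f : ℝ → ℝ} {c d : ℝ} (hf : AbsolutelyContinuousOnInterval f c d)
    (h0 : ∀ x ∈ Set.uIcc c d, f x ≠ 0) :
    AbsolutelyContinuousOnInterval (fun x => (f x)⁻¹) c d := by
  obtain ⟨C, hC⟩ := isCompact_uIcc.exists_bound_of_continuousOn (hf.continuousOn.inv₀ h0)
  have hC0 : 0 ≤ C := (norm_nonneg _).trans (hC c Set.left_mem_uIcc)
  rw [absolutelyContinuousOnInterval_iff] at hf ⊢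
  intro ε hε
  obtain ⟨η, hη, H⟩ := hf (ε / (C ^ 2 + 1)) (by positivity)
  refine ⟨η, hη, fun E hE hlt => ?_⟩
  have h1 := H E hE hlt
  have h2 : ∑ i ∈ Finset.range E.1, dist (f (E.2 i).1)⁻¹ (f (E.2 i).2)⁻¹
      ≤ (C ^ 2 + 1) * ∑ i ∈ Finset.range E.1, dist (f (E.2 i).1) (f (E.2 i).2) := by
    rw [Finset.mul_sum]
    refine Finset.sum_le_sum fun i hi => ?_
    obtain ⟨m1, m2⟩ := hE.1 i hi
    have e1 := hC _ m1
    have e2 := hC _ m2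
    have n1 := h0 _ m1
    have n2 := h0 _ m2
    rw [Real.dist_eq, Real.dist_eq]
    have : (f (E.2 i).1)⁻¹ - (f (E.2 i).2)⁻¹
        = ((f (E.2 i).1)⁻¹ * (f (E.2 i).2)⁻¹) * (f (E.2 i).2 - f (E.2 i).1) := by
      field_simp
    rw [this, abs_mul, abs_mul, abs_sub_comm (f (E.2 i).2)]
    refine mul_le_mul_of_nonneg_right ?_ (abs_nonneg _)
    have := mul_le_mul e1 e2 (norm_nonneg _) hC0
    simp only [Real.norm_eq_abs, Pi.inv_apply] at this
    nlinarith
  refine h2.trans_lt ?_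
  rw [lt_div_iff₀ (by positivity)] at h1
  linarith

theorem aux_cont {u f : ℝ → ℝ} {a b x : ℝ} (hax : a ≤ x) (hxb : x ≤ b)
    (hu : ∀ s ∈ Set.Icc a b, u s = u a + ∫ t in a..s, f t)
    (hf : IntervalIntegrable f volume a x) : ContinuousOn u (Set.Icc a x) := by
  have h := intervalIntegral.continuousOn_primitive_interval (f := f) (μ := volume) (a := a) (b := x)
    (by rw [Set.uIcc_of_le hax]; exact (intervalIntegrable_iff_integrableOn_Icc_of_le hax).1 hf)
  rw [Set.uIcc_of_le hax] at h
  refine (continuousOn_const (c := u a)).add h |>.congr ?_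
  intro s hs
  exact hu s ⟨hs.1, hs.2.trans hxb⟩

theorem aux_bdd {u v g h : ℝ → ℝ} {a b X : ℝ} (haX : a < X) (hXb : X ≤ b)
    (hg : IntegrableOn g (Set.Icc a b)) (hh : IntegrableOn h (Set.Icc a b))
    (hu : ∀ s ∈ Set.Icc a b, u s = u a + ∫ t in a..s, v t * g t)
    (hv : ∀ s ∈ Set.Icc a b, v s = v a + ∫ t in a..s, u t * h t)
    (hi : ∀ x, a ≤ x → x < X → IntervalIntegrable (fun t => v t * g t) volume a x)
    (hj : ∀ x, a ≤ x → x < X → IntervalIntegrable (fun t => u t * h t) volume a x) :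
    ∃ C, ∀ x ∈ Set.Ico a X, |u x| + |v x| ≤ C := by
  set k : ℝ → ℝ := fun t => |g t| + |h t| with hk
  have hki : IntegrableOn k (Set.Icc a b) := hg.abs.add hh.abs
  have hk0 : ∀ t, 0 ≤ k t := fun t => by positivity
  have hkint : ∀ s t, s ∈ Set.Icc a b → t ∈ Set.Icc a b → IntervalIntegrable k volume s t := by
    intro s t hs ht
    exact (hki.mono_set (Set.uIcc_subset_Icc hs ht)).intervalIntegrable
  have hX : X ∈ Set.Icc a b := ⟨haX.le, hXb⟩
  -- choose x0
  obtain ⟨x0, hx0a, hx0X, hx0⟩ : ∃ x0, a ≤ x0 ∧ x0 < X ∧ ∫ t in x0..X, k t < 1 / 2 := by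
    have hc : ContinuousOn (fun x => ∫ t in a..x, k t) (Set.Icc a b) := by
      have := intervalIntegral.continuousOn_primitive_interval (f := k) (μ := volume) (a := a) (b := b)
        (by rwa [Set.uIcc_of_le (haX.le.trans hXb)])
      rwa [Set.uIcc_of_le (haX.le.trans hXb)] at this
    have hc1 : ContinuousWithinAt (fun x => ∫ t in a..x, k t) (Set.Ico a X) X :=
      (hc X hX).mono fun z hz => ⟨hz.1, hz.2.le.trans hXb⟩
    have hc2 := hc1.eventually (lt_mem_nhds (show (∫ t in a..X, k t) - 1/2 < ∫ t in a..X, k t by linarith))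
    have hne : (nhdsWithin X (Set.Ico a X)).NeBot := by
      rw [← mem_closure_iff_nhdsWithin_neBot, closure_Ico haX.ne]
      exact ⟨haX.le, le_rfl⟩
    obtain ⟨x0, h1, h2⟩ := (hc2.and self_mem_nhdsWithin).exists
    refine ⟨x0, h2.1, h2.2, ?_⟩
    have := intervalIntegral.integral_add_adjacent_intervals
      (hkint a x0 ⟨le_rfl, haX.le.trans hXb⟩ ⟨h2.1, h2.2.le.trans hXb⟩)
      (hkint x0 X ⟨h2.1, h2.2.le.trans hXb⟩ hX)
    linarith
  have hcu : ∀ x, a ≤ x → x < X → ContinuousOn u (Set.Icc a x) := fun x h1 h2 =>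
    aux_cont h1 (h2.le.trans hXb) hu (hi x h1 h2)
  have hcv : ∀ x, a ≤ x → x < X → ContinuousOn v (Set.Icc a x) := fun x h1 h2 =>
    aux_cont h1 (h2.le.trans hXb) hv (hj x h1 h2)
  have hcm : ∀ x, a ≤ x → x < X → ContinuousOn (fun s => |u s| + |v s|) (Set.Icc a x) :=
    fun x h1 h2 => (hcu x h1 h2).abs.add (hcv x h1 h2).abs
  obtain ⟨C1, hC1⟩ := isCompact_Icc.exists_bound_of_continuousOn (hcm x0 hx0a hx0X)
  refine ⟨max C1 (2 * (|u x0| + |v x0|)), fun x hx => ?_⟩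
  rcases le_total x x0 with hxx | hxx
  · exact ((le_abs_self _).trans (hC1 x ⟨hx.1, hxx⟩)).trans (le_max_left _ _)
  · refine le_trans ?_ (le_max_right _ _)
    obtain ⟨z, hz, hzmax⟩ := isCompact_Icc.exists_isMaxOn (Set.nonempty_Icc.2 hxx)
      ((hcm x hx.1 hx.2).mono (Set.Icc_subset_Icc_left hx0a))
    have hzmax' : ∀ s ∈ Set.Icc x0 x, |u s| + |v s| ≤ |u z| + |v z| := fun s hs => hzmax hs
    set M := |u z| + |v z| with hM
    have hM0 : 0 ≤ M := by positivity
    have hzX : z < X := hz.2.trans_lt hx.2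
    have haz : a ≤ z := hx0a.trans hz.1
    have mz : z ∈ Set.Icc a b := ⟨haz, hzX.le.trans hXb⟩
    have m0 : x0 ∈ Set.Icc a b := ⟨hx0a, hx0X.le.trans hXb⟩
    have i1 : IntervalIntegrable (fun t => v t * g t) volume x0 z :=
      (hi x0 hx0a hx0X).symm.trans (hi z haz hzX)
    have i2 : IntervalIntegrable (fun t => u t * h t) volume x0 z :=
      (hj x0 hx0a hx0X).symm.trans (hj z haz hzX)
    have e1 : u z = u x0 + ∫ t in x0..z, v t * g t := by
      rw [hu z mz, hu x0 m0, ← intervalIntegral.integral_add_adjacent_intervals (hi x0 hx0a hx0X) i1]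
      ring
    have e2 : v z = v x0 + ∫ t in x0..z, u t * h t := by
      rw [hv z mz, hv x0 m0, ← intervalIntegral.integral_add_adjacent_intervals (hj x0 hx0a hx0X) i2]
      ring
    have b1 : |∫ t in x0..z, v t * g t| ≤ ∫ t in x0..z, |v t * g t| :=
      intervalIntegral.abs_integral_le_integral_abs hz.1
    have b2 : |∫ t in x0..z, u t * h t| ≤ ∫ t in x0..z, |u t * h t| :=
      intervalIntegral.abs_integral_le_integral_abs hz.1
    have b3 : (∫ t in x0..z, |v t * g t|) + ∫ t in x0..z, |u t * h t| ≤ ∫ t in x0..z, M * k t := by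
      rw [← intervalIntegral.integral_add i1.abs i2.abs]
      refine intervalIntegral.integral_mono_on hz.1 (i1.abs.add i2.abs) ((hkint x0 z m0 mz).const_mul M) ?_
      intro t ht
      have := hzmax' t ⟨ht.1, ht.2.trans hz.2⟩
      have := abs_nonneg (u t)
      have := abs_nonneg (v t)
      rw [abs_mul, abs_mul, hk]
      have a1 : |v t| * |g t| ≤ M * |g t| := mul_le_mul_of_nonneg_right (by linarith) (abs_nonneg _)
      have a2 : |u t| * |h t| ≤ M * |h t| := mul_le_mul_of_nonneg_right (by linarith) (abs_nonneg _)
      linarith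
    rw [intervalIntegral.integral_const_mul] at b3
    have b4 : ∫ t in x0..z, k t ≤ 1 / 2 := by
      have := intervalIntegral.integral_add_adjacent_intervals (hkint x0 z m0 mz) (hkint z X mz hX)
      have : 0 ≤ ∫ t in z..X, k t := intervalIntegral.integral_nonneg hzX.le fun t _ => hk0 t
      linarith
    have b5 : M * (∫ t in x0..z, k t) ≤ M * (1 / 2) := mul_le_mul_of_nonneg_left b4 hM0
    have c1 : |u z| ≤ |u x0| + |∫ t in x0..z, v t * g t| := by
      conv_lhs => rw [e1]
      exact abs_add_le _ _
    have c2 : |v z| ≤ |v x0| + |∫ t in x0..z, u t * h t| := by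
      conv_lhs => rw [e2]
      exact abs_add_le _ _
    have := hzmax' x ⟨hxx, le_rfl⟩
    linarith

theorem aux_sys {u v g h : ℝ → ℝ} {a b : ℝ} (hab : a < b)
    (hg : IntegrableOn g (Set.Icc a b)) (hh : IntegrableOn h (Set.Icc a b))
    (hu : ∀ s ∈ Set.Icc a b, u s = u a + ∫ t in a..s, v t * g t)
    (hv : ∀ s ∈ Set.Icc a b, v s = v a + ∫ t in a..s, u t * h t) :
    IntervalIntegrable (fun t => v t * g t) volume a b ∧
    IntervalIntegrable (fun t => u t * h t) volume a b := by
  have gi : ∀ x, a ≤ x → x ≤ b → IntervalIntegrable g volume a x := fun x h1 h2 =>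
    (intervalIntegrable_iff_integrableOn_Icc_of_le h1).2 (hg.mono_set (Set.Icc_subset_Icc_right h2))
  have hhi : ∀ x, a ≤ x → x ≤ b → IntervalIntegrable h volume a x := fun x h1 h2 =>
    (intervalIntegrable_iff_integrableOn_Icc_of_le h1).2 (hh.mono_set (Set.Icc_subset_Icc_right h2))
  have fwd : ∀ x, a ≤ x → x ≤ b → IntervalIntegrable (fun t => v t * g t) volume a x →
      IntervalIntegrable (fun t => u t * h t) volume a x := by
    intro x h1 h2 h3
    exact (hhi x h1 h2).continuousOn_mul (by rw [Set.uIcc_of_le h1]; exact aux_cont h1 h2 hu h3)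
  have bwd : ∀ x, a ≤ x → x ≤ b → IntervalIntegrable (fun t => u t * h t) volume a x →
      IntervalIntegrable (fun t => v t * g t) volume a x := by
    intro x h1 h2 h3
    exact (gi x h1 h2).continuousOn_mul (by rw [Set.uIcc_of_le h1]; exact aux_cont h1 h2 hv h3)
  set S : Set ℝ := {x | a ≤ x ∧ x ≤ b ∧ IntervalIntegrable (fun t => v t * g t) volume a x} with hS
  have haS : a ∈ S := ⟨le_rfl, hab.le, IntervalIntegrable.refl⟩
  have hbdd : BddAbove S := ⟨b, fun x hx => hx.2.1⟩
  set X := sSup S with hX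
  have haX : a ≤ X := le_csSup hbdd haS
  have hXb : X ≤ b := csSup_le ⟨a, haS⟩ fun x hx => hx.2.1
  have hlt : ∀ x, a ≤ x → x < X → IntervalIntegrable (fun t => v t * g t) volume a x := by
    intro x h1 h2
    obtain ⟨z, hz, hxz⟩ := exists_lt_of_lt_csSup ⟨a, haS⟩ h2
    refine hz.2.2.mono_set ?_
    rw [Set.uIcc_of_le h1, Set.uIcc_of_le hz.1]
    exact Set.Icc_subset_Icc_right hxz.le
  have hXS : IntervalIntegrable (fun t => v t * g t) volume a X := by
    rcases haX.eq_or_lt with e | haX'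
    · rw [← e]
    · have hlt2 : ∀ x, a ≤ x → x < X → IntervalIntegrable (fun t => u t * h t) volume a x :=
        fun x h1 h2 => fwd x h1 (h2.le.trans hXb) (hlt x h1 h2)
      obtain ⟨C, hC⟩ := aux_bdd haX' hXb hg hh hu hv hlt hlt2
      have hcv : ContinuousOn v (Set.Ico a X) := by
        intro x hx
        obtain ⟨x', h1, h2⟩ := exists_between hx.2
        have := aux_cont (hx.1.trans h1.le) (h2.le.trans hXb) hv (hlt2 x' (hx.1.trans h1.le) h2)
        refine (this x ⟨hx.1, h1.le⟩).mono_of_mem_nhdsWithin ?_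
        refine Filter.mem_of_superset (inter_mem_nhdsWithin _ (Iio_mem_nhds h1)) ?_
        intro s hs
        exact ⟨hs.1.1, le_of_lt hs.2⟩
      rw [intervalIntegrable_iff_integrableOn_Ico_of_le haX]
      have g1 : IntegrableOn g (Set.Ico a X) :=
        hg.mono_set fun z hz => ⟨hz.1, hz.2.le.trans hXb⟩
      refine Integrable.bdd_mul (c := C) g1 (hcv.aestronglyMeasurable measurableSet_Ico) ?_
      filter_upwards [ae_restrict_mem measurableSet_Ico] with x hx
      have := hC x hx
      have := abs_nonneg (u x)
      rw [Real.norm_eq_abs]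
      linarith
  have hmain : IntervalIntegrable (fun t => v t * g t) volume a b := by
    by_contra hcon
    have hXb' : X < b := by
      rcases hXb.eq_or_lt with e | h1
      · exact absurd (e ▸ hXS) hcon
      · exact h1
    have hno : ∀ x, X < x → x ≤ b → ¬ IntervalIntegrable (fun t => v t * g t) volume a x := by
      intro x h1 h2 h3
      exact absurd (le_csSup hbdd (show x ∈ S from ⟨haX.trans h1.le, h2, h3⟩)) (not_le.2 h1)
    have huc : ∀ x, X < x → x ≤ b → u x = u a := by
      intro x h1 h2
      rw [hu x ⟨haX.trans h1.le, h2⟩, intervalIntegral.integral_undef (hno x h1 h2), add_zero]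
    have i2 : IntervalIntegrable (fun t => u t * h t) volume X b := by
      have h1 : IntegrableOn (fun t => u a * h t) (Set.Ioc X b) :=
        (hh.mono_set fun z hz => ⟨haX.trans hz.1.le, hz.2⟩).const_mul _
      rw [intervalIntegrable_iff_integrableOn_Ioc_of_le hXb]
      refine h1.congr_fun ?_ measurableSet_Ioc
      intro x hx
      simp only [huc x hx.1 hx.2]
    exact hcon (bwd b hab.le le_rfl ((fwd X haX hXb hXS).trans i2))
  exact ⟨hmain, fwd b hab.le le_rfl hmain⟩

theorem aux_deriv {u f : ℝ → ℝ} {a b : ℝ} (hab : a < b)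
    (hu : ∀ s ∈ Set.Icc a b, u s = u a + ∫ t in a..s, f t)
    (hf : IntervalIntegrable f volume a b) :
    ∀ᵐ x, x ∈ Set.Ioo a b → HasDerivAt u (f x) x := by
  filter_upwards [hf.ae_hasDerivAt_integral] with x hx hxm
  rw [Set.uIcc_of_le hab.le] at hx
  have h1 := (hx (Set.Ioo_subset_Icc_self hxm) a (Set.left_mem_Icc.2 hab.le)).const_add (u a)
  refine h1.congr_of_eventuallyEq ?_
  filter_upwards [Ioo_mem_nhds hxm.1 hxm.2] with s hs
  exact hu s (Set.Ioo_subset_Icc_self hs)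

theorem aux_ac {u f : ℝ → ℝ} {a b : ℝ} (hab : a < b)
    (hu : ∀ s ∈ Set.Icc a b, u s = u a + ∫ t in a..s, f t)
    (hf : IntervalIntegrable f volume a b) :
    AbsolutelyContinuousOnInterval u a b := by
  have h := hf.absolutelyContinuousOnInterval_intervalIntegral (c := a) Set.left_mem_uIcc
  rw [absolutelyContinuousOnInterval_iff] at h ⊢
  intro ε hε
  obtain ⟨η, hη, H⟩ := h ε hε
  refine ⟨η, hη, fun E hE hlt => ?_⟩
  refine lt_of_eq_of_lt (Finset.sum_congr rfl fun i hi => ?_) (H E hE hlt)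
  obtain ⟨m1, m2⟩ := hE.1 i hi
  rw [Set.uIcc_of_le hab.le] at m1 m2
  rw [hu _ m1, hu _ m2, dist_add_left]

/-- Oscillation-forcing: if `∫ r₊ > 0`, `p ≤ P` and `r ≥ δ > 0` on some subinterval
`[c,d] ⊂ (a,b)`, then for all sufficiently large real `λ` every nontrivial real
solution of `-(p y')' + q y = λ r y` has a zero in `(a,b)`. -/
theorem large_lambda_forces_zero
    (p q r : ℝ → ℝ) (a b : ℝ) (hab : a < b)
    (hp : ∀ᵐ x ∂(volume.restrict (Set.Icc a b)), 0 < p x)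
    (hq : IntegrableOn q (Set.Icc a b))
    (hr : IntegrableOn r (Set.Icc a b))
    (hip : IntegrableOn (fun x => (p x)⁻¹) (Set.Icc a b))
    (hrplus : 0 < ∫ x in a..b, max (r x) 0)
    (c d P δ : ℝ) (hac : a < c) (hcd : c < d) (hdb : d < b)
    (hP : ∀ x ∈ Set.Icc c d, p x ≤ P)
    (hδ : 0 < δ) (hrδ : ∀ x ∈ Set.Icc c d, δ ≤ r x) :
    ∃ Λ : ℝ, ∀ l : ℝ, Λ ≤ l →
      ∀ y py : ℝ → ℝ, IsRealSLSolution p q r a b l y py →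
        (∃ x ∈ Set.Icc a b, y x ≠ 0) →
        ∃ x ∈ Set.Ioo a b, y x = 0 := by
  have hcdI : Set.Icc c d ⊆ Set.Icc a b := Set.Icc_subset_Icc hac.le hdb.le
  have qi : IntervalIntegrable q volume c d :=
    (intervalIntegrable_iff_integrableOn_Icc_of_le hcd.le).2 (hq.mono_set hcdI)
  set ph : ℝ → ℝ := fun x => ((x - c) * (d - x)) ^ 2 with hph
  set G : ℝ → ℝ := fun x => P * (c + d - 2 * x) ^ 2 + ph x * q x with hG
  have phc : Continuous ph := by fun_prop
  have phi : IntervalIntegrable ph volume c d := phc.intervalIntegrable _ _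
  have Gi : IntervalIntegrable G volume c d :=
    (Continuous.intervalIntegrable (by fun_prop) _ _).add (qi.continuousOn_mul phc.continuousOn)
  set B := ∫ x in c..d, ph x with hB
  have hB0 : 0 < B := by
    refine intervalIntegral.intervalIntegral_pos_of_pos_on phi ?_ hcd
    intro x hx
    have h1 : 0 < x - c := by linarith [hx.1]
    have h2 : 0 < d - x := by linarith [hx.2]
    simp only [hph]
    positivity
  set A := ∫ x in c..d, G x with hA
  refine ⟨max 0 (A / (δ * B) + 1), fun l hl y py hsol _ => ?_⟩
  have hl0 : 0 ≤ l := (le_max_left _ _).trans hl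
  have hlA : A / (δ * B) + 1 ≤ l := (le_max_right _ _).trans hl
  by_contra hcon
  have hne : ∀ x ∈ Set.uIcc c d, y x ≠ 0 := by
    intro x hx h0
    rw [Set.uIcc_of_le hcd.le] at hx
    exact hcon ⟨x, ⟨hac.trans_le hx.1, hx.2.trans_lt hdb⟩, h0⟩
  obtain ⟨hy, hpy⟩ := hsol
  have hy' : ∀ s ∈ Set.Icc a b, y s = y a + ∫ t in a..s, py t * (p t)⁻¹ := by
    simpa only [div_eq_mul_inv] using hy
  have hpy' : ∀ s ∈ Set.Icc a b, py s = py a + ∫ t in a..s, y t * (q t - l * r t) := by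
    intro s hs
    rw [hpy s hs]
    congr 2
    ext t
    ring
  obtain ⟨I1, I2⟩ := aux_sys hab hip (hq.sub (hr.const_mul l)) hy' hpy'
  have hsub : Set.uIcc c d ⊆ Set.uIcc a b := by
    rwa [Set.uIcc_of_le hcd.le, Set.uIcc_of_le hab.le]
  have acy := (aux_ac hab hy' I1).mono hsub
  have acpy := (aux_ac hab hpy' I2).mono hsub
  have acph : AbsolutelyContinuousOnInterval ph c d := by
    apply ContDiffOn.absolutelyContinuousOnInterval
    exact ContDiff.contDiffOn (by fun_prop)
  have acF := (acph.fun_mul acpy).fun_mul (aux_ac_inv acy hne)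
  have h0 := acF.integral_deriv_eq_sub
  have hle : ∫ x in c..d, deriv (fun x => ph x * py x * (y x)⁻¹) x
      ≤ ∫ x in c..d, (G x - l * δ * ph x) := by
    refine intervalIntegral.integral_mono_ae_restrict hcd.le acF.intervalIntegrable_deriv
      (Gi.sub (phi.const_mul _)) ?_
    have hp' : ∀ᵐ x ∂(volume.restrict (Set.Icc c d)), 0 < p x := ae_restrict_of_ae_restrict_of_subset hcdI hp
    filter_upwards [hp', ae_restrict_mem measurableSet_Icc,
      ae_restrict_of_ae (aux_deriv hab hy' I1), ae_restrict_of_ae (aux_deriv hab hpy' I2)]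
      with x hpx hx d1 d2
    have hxo : x ∈ Set.Ioo a b := ⟨hac.trans_le hx.1, hx.2.trans_lt hdb⟩
    have yn : y x ≠ 0 := hne x (by rwa [Set.uIcc_of_le hcd.le])
    have D1 := d1 hxo
    have D2 := d2 hxo
    have Dph : HasDerivAt ph (2 * ((x - c) * (d - x)) * (c + d - 2 * x)) x := by
      have := (((hasDerivAt_id x).sub_const c).mul ((hasDerivAt_id x).const_sub d)).pow 2
      refine HasDerivAt.congr_deriv this ?_
      simp only [Pi.mul_apply, id]
      norm_num only
      ring
    have DF := (Dph.mul D2).mul (D1.inv yn)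
    have DF' : deriv (fun x => ph x * py x * (y x)⁻¹) x = _ := DF.deriv
    rw [DF']
    simp only [Pi.mul_apply, Pi.inv_apply]
    have hPx := hP x hx
    have hrx := hrδ x hx
    set w := py x / y x with hw
    have hpw : py x = w * y x := by rw [hw]; field_simp
    set f := (x - c) * (d - x) with hf
    set f' := c + d - 2 * x with hf'
    have hphx : ph x = f ^ 2 := rfl
    have e : (2 * f * f' * py x + ph x * (y x * (q x - l * r x))) * (y x)⁻¹
        + ph x * py x * (-(py x * (p x)⁻¹) / y x ^ 2)
        = 2 * f * f' * w + f ^ 2 * (q x - l * r x) - f ^ 2 * w ^ 2 / p x := by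
      rw [hpw, hphx]
      field_simp
      ring
    rw [e]
    have s1 : 2 * f * f' * w - f ^ 2 * w ^ 2 / p x ≤ p x * f' ^ 2 := by
      have : p x * f' ^ 2 - (2 * f * f' * w - f ^ 2 * w ^ 2 / p x)
          = (p x * f' - f * w) ^ 2 / p x := by
        field_simp
        ring
      have : 0 ≤ (p x * f' - f * w) ^ 2 / p x := by positivity
      linarith
    have s2 : p x * f' ^ 2 ≤ P * f' ^ 2 := mul_le_mul_of_nonneg_right hPx (sq_nonneg _)
    have s3 : l * δ * f ^ 2 ≤ l * r x * f ^ 2 :=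
      mul_le_mul_of_nonneg_right (mul_le_mul_of_nonneg_left hrx hl0) (sq_nonneg _)
    simp only [hG, hphx]
    linarith
  rw [h0, intervalIntegral.integral_sub Gi (phi.const_mul _),
    intervalIntegral.integral_const_mul] at hle
  have z1 : ph d = 0 := by simp [hph]
  have z2 : ph c = 0 := by simp [hph]
  rw [z1, z2] at hle
  have hδB : 0 < δ * B := by positivity
  have : A / (δ * B) < l := by linarith
  rw [div_lt_iff₀ hδB] at this
  simp only [zero_mul, sub_zero] at hle
  nlinarith
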